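/- Let (Ω₁, F₁, P₁) be a probability space and Ψ : Ω₁ → ℝ an arbitrary function such that a minimal measurable majorant of |Ψ| is P₁-integrable. For n ≥ 1, let Ψ'ₙ = Ψ·1_{{|Ψ| ≤ n}} be the truncation of Ψ at level n, and let (Ψ'ₙ)^* and Ψ^* be minimal measurable majorants of Ψ'ₙ and Ψ respectively, and (Ψ'ₙ)_* and Ψ_* maximal measurable minorants of Ψ'ₙ and Ψ respectively. Then ∫ (Ψ'ₙ)^* dP₁ → ∫ Ψ^* dP₁ and ∫ (Ψ'ₙ)_* dP₁ → ∫ Ψ_* dP₁ as n → ∞. -/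

import Mathlib

open MeasureTheory Filter Topology

/-- `flow` is a maximal measurable minorant of `f` with respect to the measure `P`. -/
def IsMeasMinorant {Ω : Type*} [MeasurableSpace Ω] (P : Measure Ω) (f flow : Ω → ℝ) : Prop :=
  Measurable flow ∧ (∀ ω, flow ω ≤ f ω) ∧
    ∀ g : Ω → ℝ, Measurable g → (∀ ω, g ω ≤ f ω) → ∀ᵐ ω ∂P, g ω ≤ flow ω

/-- `fup` is a minimal measurable majorant of `f` with respect to the measure `P`. -/
def IsMeasMajorant {Ω : Type*} [MeasurableSpace Ω] (P : Measure Ω) (f fup : Ω → ℝ) : Prop :=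
  Measurable fup ∧ (∀ ω, f ω ≤ fup ω) ∧
    ∀ h : Ω → ℝ, Measurable h → (∀ ω, f ω ≤ h ω) → ∀ᵐ ω ∂P, fup ω ≤ h ω

theorem IsMeasMinorant.neg {Ω : Type*} [MeasurableSpace Ω] {P : Measure Ω} {f flow : Ω → ℝ}
    (h : IsMeasMinorant P f flow) :
    IsMeasMajorant P (fun x => -f x) (fun x => -flow x) := by
  refine ⟨h.1.neg, fun ω => neg_le_neg (h.2.1 ω), fun g hg hfg => ?_⟩
  filter_upwards [h.2.2 (fun x => -g x) hg.neg fun ω => neg_le.mp (hfg ω)] with ω hω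
  exact neg_le.mp hω

/-- Minimal measurable majorants are compared locally, on measurable sets. -/
theorem IsMeasMajorant.ae_le_of_le_on {Ω : Type*} [MeasurableSpace Ω] {P : Measure Ω}
    {f f' fup fup' : Ω → ℝ} (h : IsMeasMajorant P f fup) (h' : IsMeasMajorant P f' fup')
    {s : Set Ω} (hs : MeasurableSet s) (hle : ∀ ω ∈ s, f ω ≤ f' ω) :
    ∀ᵐ ω ∂P, ω ∈ s → fup ω ≤ fup' ω := by
  classical
  filter_upwards [h.2.2 (s.piecewise fup' fup) (h'.1.piecewise hs h.1) fun ω => by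
    by_cases hω : ω ∈ s
    · simpa [hω] using (hle ω hω).trans (h'.2.1 ω)
    · simpa [hω] using h.2.1 ω] with ω hω hmem
  simpa [hmem] using hω

/-- Integrals of minimal measurable majorants converge when the functions are dominated by an
integrable `g` and agree with the limit on the sublevel sets `{g ≤ n}`. -/
theorem IsMeasMajorant.tendsto_integral {Ω : Type*} [MeasurableSpace Ω] {P : Measure Ω}
    {f fup g : Ω → ℝ} {F Fup : ℕ → Ω → ℝ} (hg : Measurable g) (hgi : Integrable g P)
    (hf : IsMeasMajorant P f fup) (hF : ∀ n : ℕ, 1 ≤ n → IsMeasMajorant P (F n) (Fup n))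
    (hbound : ∀ n ω, |F n ω| ≤ g ω) (heq : ∀ (n : ℕ) (ω : Ω), g ω ≤ n → F n ω = f ω) :
    Tendsto (fun n : ℕ => ∫ x, Fup n x ∂P) atTop (𝓝 (∫ x, fup x ∂P)) := by
  refine tendsto_integral_filter_of_dominated_convergence g ?_ ?_ hgi ?_
  · filter_upwards [eventually_ge_atTop 1] with n hn
    exact (hF n hn).1.aestronglyMeasurable
  · filter_upwards [eventually_ge_atTop 1] with n hn
    filter_upwards [(hF n hn).2.2 g hg fun ω => (abs_le.mp (hbound n ω)).2] with ω hω
    exact abs_le.mpr ⟨(abs_le.mp (hbound n ω)).1.trans ((hF n hn).2.1 ω), hω⟩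
  · have hs (n : ℕ) : MeasurableSet {ω | g ω ≤ n} := measurableSet_le hg measurable_const
    have hae : ∀ᵐ ω ∂P, ∀ n : ℕ, 1 ≤ n → g ω ≤ n → Fup n ω = fup ω := by
      refine ae_all_iff.mpr fun n => ?_
      by_cases hn : 1 ≤ n
      · filter_upwards [(hF n hn).ae_le_of_le_on hf (hs n) fun ω hω => (heq n ω hω).le,
          hf.ae_le_of_le_on (hF n hn) (hs n) fun ω hω => (heq n ω hω).ge] with ω h₁ h₂ _ hω
        exact le_antisymm (h₁ hω) (h₂ hω)
      · exact Eventually.of_forall fun ω h => absurd h hn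
    filter_upwards [hae] with ω hω
    refine tendsto_const_nhds.congr' ?_
    filter_upwards [eventually_ge_atTop 1, eventually_ge_atTop ⌈g ω⌉₊] with n hn hgn
    exact (hω n hn (Nat.ceil_le.mp hgn)).symm

/-- **Convergence of integrals of minorants/majorants of truncations.** Let `Ψ : Ω₁ → ℝ` be
arbitrary with an integrable minimal measurable majorant of `|Ψ|`. For `n ≥ 1`, let
`Ψ'ₙ = Ψ · 1_{|Ψ| ≤ n}` and let `Φup n`, `Φlow n` be a minimal measurable majorant and a
maximal measurable minorant of `Ψ'ₙ`. Then `∫ Φup n dP₁ → ∫ Ψup dP₁` and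
`∫ Φlow n dP₁ → ∫ Ψlow dP₁`, where `Ψup`, `Ψlow` are a minimal measurable majorant and a
maximal measurable minorant of `Ψ`. -/
theorem integral_truncation_minorant_majorant_tendsto
    {Ω₁ : Type*} [MeasurableSpace Ω₁] (P₁ : Measure Ω₁) [IsProbabilityMeasure P₁]
    (Ψ Ψlow Ψup Ψabs : Ω₁ → ℝ)
    (hΨlow : IsMeasMinorant P₁ Ψ Ψlow)
    (hΨup : IsMeasMajorant P₁ Ψ Ψup)
    (hΨabs : IsMeasMajorant P₁ (fun x => |Ψ x|) Ψabs)
    (hInt : Integrable Ψabs P₁)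
    (Φlow Φup : ℕ → Ω₁ → ℝ)
    (hΦlow : ∀ n : ℕ, 1 ≤ n →
      IsMeasMinorant P₁ (fun x => if |Ψ x| ≤ n then Ψ x else 0) (Φlow n))
    (hΦup : ∀ n : ℕ, 1 ≤ n →
      IsMeasMajorant P₁ (fun x => if |Ψ x| ≤ n then Ψ x else 0) (Φup n)) :
    Tendsto (fun n : ℕ => ∫ x, Φup n x ∂P₁) atTop (𝓝 (∫ x, Ψup x ∂P₁)) ∧
    Tendsto (fun n : ℕ => ∫ x, Φlow n x ∂P₁) atTop (𝓝 (∫ x, Ψlow x ∂P₁)) := by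
  have hbound (n : ℕ) (ω : Ω₁) : |if |Ψ ω| ≤ n then Ψ ω else 0| ≤ Ψabs ω := by
    split_ifs
    · exact hΨabs.2.1 ω
    · simpa using (abs_nonneg _).trans (hΨabs.2.1 ω)
  have heq (n : ℕ) (ω : Ω₁) (hω : Ψabs ω ≤ n) : (if |Ψ ω| ≤ n then Ψ ω else 0) = Ψ ω :=
    if_pos ((hΨabs.2.1 ω).trans hω)
  refine ⟨hΨup.tendsto_integral hΨabs.1 hInt hΦup hbound heq, ?_⟩
  have h := hΨlow.neg.tendsto_integral hΨabs.1 hInt (fun n hn => (hΦlow n hn).neg)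
    (fun n ω => (abs_neg _).trans_le (hbound n ω)) fun n ω hω => congrArg Neg.neg (heq n ω hω)
  simpa [integral_neg] using h.neg
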